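/- arXiv:2307.06597 — 2 statements merged into one kernel-verified Lean document; each statement's English description precedes it below -/
import Mathlib

section
/- Let ρ : ℝ⁴ → ℝ and j : ℝ⁴ → ℝ³ be smooth (coordinates (t,x) with x ∈ ℝ³) satisfying the continuity equation ∂_tρ + div j = 0 everywhere. Then there exist smooth maps ℰ : ℝ⁴ → ℝ³ and ℬ : ℝ⁴ → ℝ³ such that div ℰ = ρ and −∂_tℰ + curl ℬ = j everywhere (Maxwell–Gauss and Maxwell–Ampère equations with source (ρ,j)). -/
noncomputable section

/-- A point of `ℝ⁴ = ℝ × ℝ³`, written `(t, x)` with `t ∈ ℝ` the time and `x ∈ ℝ³` the space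
variable. -/
abbrev Pt : Type := ℝ × (Fin 3 → ℝ)

variable {E : Type*} [NormedAddCommGroup E] [NormedSpace ℝ E]

/-- Time derivative `∂_t f`. -/
def timeDeriv (f : Pt → E) (p : Pt) : E := fderiv ℝ f p (1, 0)

/-- Spatial partial derivative `∂_{xᵢ} f` (`i = 0, 1, 2` indexing `x₁, x₂, x₃`). -/
def spaceDeriv (i : Fin 3) (f : Pt → E) (p : Pt) : E := fderiv ℝ f p (0, Pi.single i 1)

/-- Spatial divergence `div F = ∂_{x₁}F₁ + ∂_{x₂}F₂ + ∂_{x₃}F₃` of a time-dependent vector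
field. -/
def div3 (F : Pt → Fin 3 → ℝ) (p : Pt) : ℝ := ∑ i : Fin 3, spaceDeriv i F p i

/-- Spatial curl
`curl F = (∂_{x₂}F₃ − ∂_{x₃}F₂, ∂_{x₃}F₁ − ∂_{x₁}F₃, ∂_{x₁}F₂ − ∂_{x₂}F₁)` of a time-dependent
vector field. -/
def curl3 (F : Pt → Fin 3 → ℝ) (p : Pt) : Fin 3 → ℝ :=
  ![spaceDeriv 1 F p 2 - spaceDeriv 2 F p 1,
    spaceDeriv 2 F p 0 - spaceDeriv 0 F p 2,
    spaceDeriv 0 F p 1 - spaceDeriv 1 F p 0]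

/-- Spatial gradient of a time-dependent scalar field. -/
def grad3 (f : Pt → ℝ) (p : Pt) : Fin 3 → ℝ := fun i => spaceDeriv i f p

/-- Spatial Laplacian `Δf = div (grad f)` of a time-dependent scalar field. -/
def lap3 (f : Pt → ℝ) (p : Pt) : ℝ := ∑ i : Fin 3, spaceDeriv i (fun q => spaceDeriv i f q) p

universe u

section ParametricIntegral

variable {H V : Type u} [NormedAddCommGroup H] [NormedSpace ℝ H] [NormedAddCommGroup V]
  [NormedSpace ℝ V]

theorem hasFDerivAt_intervalIntegral_of_contDiff [LocallyCompactSpace H] {F : H × ℝ → V}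
    (hF : ContDiff ℝ 1 F) (a b : ℝ) (x : H) :
    HasFDerivAt (fun y => ∫ s in a..b, F (y, s))
      (∫ s in a..b, (fderiv ℝ F (x, s)).comp (ContinuousLinearMap.inl ℝ H ℝ)) x := by
  have hF' : Continuous fun q : H × ℝ =>
      (fderiv ℝ F q).comp (ContinuousLinearMap.inl ℝ H ℝ) :=
    (hF.continuous_fderiv one_ne_zero).clm_comp continuous_const
  obtain ⟨K, hK, hxK⟩ := exists_compact_mem_nhds x
  obtain ⟨C, hC⟩ := (hK.prod (isCompact_uIcc (a := a) (b := b))).exists_bound_of_continuousOn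
    hF'.continuousOn
  have hslice : ∀ y, Continuous fun s : ℝ => F (y, s) := fun y =>
    hF.continuous.comp (by fun_prop)
  refine intervalIntegral.hasFDerivAt_integral_of_dominated_of_fderiv_le (𝕜 := ℝ)
    (F' := fun y s => (fderiv ℝ F (y, s)).comp (ContinuousLinearMap.inl ℝ H ℝ))
    (bound := fun _ => C) hxK ?_ ((hslice x).intervalIntegrable _ _) ?_ ?_
    intervalIntegrable_const ?_
  · exact Filter.Eventually.of_forall fun y => (hslice y).aestronglyMeasurable
  · exact (hF'.comp (by fun_prop : Continuous fun s : ℝ => (x, s))).aestronglyMeasurable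
  · exact Filter.Eventually.of_forall fun s hs y hy =>
      hC (y, s) ⟨hy, Set.uIoc_subset_uIcc hs⟩
  · refine Filter.Eventually.of_forall fun s _ y _ => ?_
    exact (hF.differentiable one_ne_zero (y, s)).hasFDerivAt.comp y (hasFDerivAt_prodMk_left y s)

theorem contDiff_intervalIntegral [LocallyCompactSpace H] {F : H × ℝ → V} (n : ℕ)
    (hF : ContDiff ℝ n F) (a b : ℝ) : ContDiff ℝ n fun y => ∫ s in a..b, F (y, s) := by
  induction n generalizing V with
  | zero =>
    rw [Nat.cast_zero, contDiff_zero] at hF ⊢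
    exact intervalIntegral.continuous_parametric_intervalIntegral_of_continuous' (by exact hF) a b
  | succ n ih =>
    push_cast at hF ⊢
    refine contDiff_succ_iff_hasFDerivAt.2 ⟨_, ?_,
      hasFDerivAt_intervalIntegral_of_contDiff (hF.of_le le_add_self) a b⟩
    exact ih (F := fun q => (fderiv ℝ F q).comp (ContinuousLinearMap.inl ℝ H ℝ))
      ((hF.fderiv_right le_rfl).clm_comp contDiff_const)

end ParametricIntegral

/-- The primitive of `f` in the direction `v` that vanishes on the hyperplane `c = 0`, where
`c v = 1`. -/
def primitive (c : Pt →L[ℝ] ℝ) (v : Pt) (f : Pt → ℝ) (p : Pt) : ℝ :=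
  ∫ s in (0 : ℝ)..c p, f (p + (s - c p) • v)

section Primitive

variable {c : Pt →L[ℝ] ℝ} {v : Pt} {f : Pt → ℝ}

theorem primitive_eq_mul_integral (c : Pt →L[ℝ] ℝ) (v : Pt) (f : Pt → ℝ) (p : Pt) :
    primitive c v f p = c p * ∫ s in (0 : ℝ)..1, f (p + ((s - 1) * c p) • v) := by
  have h := intervalIntegral.smul_integral_comp_mul_left (a := 0) (b := 1)
    (fun s => f (p + (s - c p) • v)) (c p)
  simp only [mul_zero, mul_one, smul_eq_mul] at h
  rw [primitive, ← h]
  congr 2 with s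
  congr 3
  ring

theorem contDiff_primitive (c : Pt →L[ℝ] ℝ) (v : Pt) (hf : ContDiff ℝ (⊤ : ℕ∞) f) :
    ContDiff ℝ (⊤ : ℕ∞) (primitive c v f) := by
  rw [funext (primitive_eq_mul_integral c v f)]
  refine c.contDiff.mul (contDiff_infty.2 fun n => ?_)
  refine contDiff_intervalIntegral (F := fun q : Pt × ℝ => f (q.1 + ((q.2 - 1) * c q.1) • v)) n
    (ContDiff.comp (hf.of_le (mod_cast le_top)) ?_) 0 1
  fun_prop

theorem fderiv_primitive_self (hcv : c v = 1) (hf : ContDiff ℝ (⊤ : ℕ∞) f) (p : Pt) :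
    fderiv ℝ (primitive c v f) p v = f p := by
  have hd := ((contDiff_primitive c v hf).differentiable (by simp) p).hasFDerivAt
  have h₁ : HasDerivAt (fun h : ℝ => primitive c v f (p + h • v))
      (fderiv ℝ (primitive c v f) p v) 0 := hd.hasLineDerivAt v
  have hcont : Continuous fun s : ℝ => f (p + (s - c p) • v) := hf.continuous.comp (by fun_prop)
  have h₂ : HasDerivAt (fun h : ℝ => ∫ s in (0 : ℝ)..c p + h, f (p + (s - c p) • v)) (f p) 0 := by
    have := (hcont.integral_hasStrictDerivAt 0 (c p + 0)).hasDerivAt.comp_const_add (c p) 0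
    simpa using this
  refine h₁.unique (h₂.congr_of_eventuallyEq (Filter.Eventually.of_forall fun h => ?_))
  simp only [primitive, map_add, map_smul, hcv, smul_eq_mul, mul_one]
  congr 1 with s
  congr 1
  module

theorem fderiv_primitive_of_apply_eq_zero {w : Pt} (hcw : c w = 0) (hf : ContDiff ℝ (⊤ : ℕ∞) f)
    (p : Pt) :
    fderiv ℝ (primitive c v f) p w = primitive c v (fun q => fderiv ℝ f q w) p := by
  set g : Pt × ℝ → Pt := fun q => q.1 + ((q.2 - 1) * c q.1) • v with hg
  have hgs : ContDiff ℝ 1 g := by fun_prop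
  have hF : ContDiff ℝ 1 (fun q => f (g q)) := (hf.of_le (mod_cast le_top)).comp hgs
  have hJ := hasFDerivAt_intervalIntegral_of_contDiff hF 0 1 p
  have hint : IntervalIntegrable (fun s : ℝ => (fderiv ℝ (fun q => f (g q)) (p, s)).comp
      (ContinuousLinearMap.inl ℝ Pt ℝ)) MeasureTheory.volume 0 1 := by
    refine Continuous.intervalIntegrable ?_ _ _
    exact ((hF.continuous_fderiv one_ne_zero).comp (by fun_prop)).clm_comp continuous_const
  have hpt : ∀ s : ℝ, ((fderiv ℝ (fun q => f (g q)) (p, s)).comp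
      (ContinuousLinearMap.inl ℝ Pt ℝ)) w = fderiv ℝ f (g (p, s)) w := by
    intro s
    have h₁ := ((hF.differentiable one_ne_zero (p, s)).hasFDerivAt.hasLineDerivAt (w, 0))
    have h₂ := ((hf.differentiable (by simp) (g (p, s))).hasFDerivAt.hasLineDerivAt w)
    refine h₁.unique (HasDerivAt.congr_of_eventuallyEq h₂
      (Filter.Eventually.of_forall fun h => ?_))
    simp only [hg, Prod.mk_add_mk, Prod.smul_mk, smul_zero, add_zero, map_add, map_smul, hcw]
    congr 1
    abel
  have hP : HasFDerivAt (fun q => c q * ∫ s in (0 : ℝ)..1, f (q + ((s - 1) * c q) • v)) _ p :=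
    c.hasFDerivAt.mul hJ
  rw [funext (primitive_eq_mul_integral c v f), primitive_eq_mul_integral, hP.fderiv]
  simp only [add_apply, smul_apply, smul_eq_mul, hcw, mul_zero, add_zero]
  rw [ContinuousLinearMap.intervalIntegral_apply hint]
  exact congrArg _ (intervalIntegral.integral_congr fun s _ => hpt s)

theorem primitive_fderiv_self (hf : ContDiff ℝ (⊤ : ℕ∞) f) (p : Pt) :
    primitive c v (fun q => fderiv ℝ f q v) p = f p - f (p - c p • v) := by
  have hd : ∀ s : ℝ, HasDerivAt (fun s : ℝ => f (p + (s - c p) • v))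
      (fderiv ℝ f (p + (s - c p) • v) v) s := by
    intro s
    refine (hf.differentiable (by simp) _).hasFDerivAt.comp_hasDerivAt s ?_
    simpa using (((hasDerivAt_id s).sub_const (c p)).smul_const v).const_add p
  have hcont : Continuous fun s : ℝ => fderiv ℝ f (p + (s - c p) • v) v :=
    ((hf.continuous_fderiv (by simp)).comp (by fun_prop)).clm_apply continuous_const
  rw [primitive, intervalIntegral.integral_eq_sub_of_hasDerivAt (fun s _ => hd s)
    (hcont.intervalIntegrable _ _)]
  simp [sub_eq_add_neg]

theorem primitive_add {g : Pt → ℝ} (hf : Continuous f) (hg : Continuous g) (p : Pt) :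
    primitive c v (fun q => f q + g q) p = primitive c v f p + primitive c v g p :=
  intervalIntegral.integral_add
    ((hf.comp (by fun_prop)).intervalIntegrable _ _)
    ((hg.comp (by fun_prop)).intervalIntegrable _ _)

theorem primitive_neg (p : Pt) :
    primitive c v (fun q => -f q) p = -primitive c v f p :=
  intervalIntegral.integral_neg

end Primitive

theorem fderiv_apply_component {F : Pt → Fin 3 → ℝ} {p : Pt} (hF : DifferentiableAt ℝ F p)
    (w : Pt) (k : Fin 3) : fderiv ℝ F p w k = fderiv ℝ (fun q => F q k) p w := by
  rw [fderiv_apply hF]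
  rfl

/-- Let `ρ : ℝ⁴ → ℝ` and `j : ℝ⁴ → ℝ³` be smooth and satisfy the continuity
equation `∂_tρ + div j = 0` everywhere. Then there exist smooth maps `ℰ, ℬ : ℝ⁴ → ℝ³` such
that `div ℰ = ρ` and `−∂_tℰ + curl ℬ = j` everywhere (Maxwell–Gauss and Maxwell–Ampère
equations with source `(ρ, j)`). -/
theorem exists_field_of_conserved (ρ : Pt → ℝ) (j : Pt → Fin 3 → ℝ)
    (hρ : ContDiff ℝ (⊤ : ℕ∞) ρ) (hj : ContDiff ℝ (⊤ : ℕ∞) j)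
    (hcont : ∀ p : Pt, timeDeriv ρ p + div3 j p = 0) :
    ∃ (ℰ ℬ : Pt → Fin 3 → ℝ), ContDiff ℝ (⊤ : ℕ∞) ℰ ∧ ContDiff ℝ (⊤ : ℕ∞) ℬ ∧
      (∀ p : Pt, div3 ℰ p = ρ p) ∧
      (∀ p : Pt, -timeDeriv ℰ p + curl3 ℬ p = j p) := by
  have hjc : ∀ k, ContDiff ℝ (⊤ : ℕ∞) fun q => j q k := contDiff_pi.1 hj
  let x₁ : Pt →L[ℝ] ℝ := (ContinuousLinearMap.proj 0).comp (ContinuousLinearMap.snd ℝ ℝ _)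
  let time : Pt →L[ℝ] ℝ := ContinuousLinearMap.fst ℝ ℝ _
  let e : Fin 3 → Pt := fun i => (0, Pi.single i 1)
  let P : Pt →L[ℝ] Pt := ContinuousLinearMap.id ℝ Pt - x₁.smulRight (e 0)
  have hx0 : x₁ (e 0) = 1 := by simp [x₁, e]
  have hx1 : x₁ (e 1) = 0 := by simp [x₁, e]
  have hx2 : x₁ (e 2) = 0 := by simp [x₁, e]
  have hxt : x₁ (1, 0) = 0 := by simp [x₁]
  have ht0 : time (e 0) = 0 := by simp [time, e]
  have htt : time (1, 0) = 1 := by simp [time]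
  let f : Pt → ℝ := fun q => j (P q) 0
  have hf : ContDiff ℝ (⊤ : ℕ∞) f := (hjc 0).comp P.contDiff
  have hf0 : ∀ q, fderiv ℝ f q (e 0) = 0 := by
    intro q
    have h := ((hjc 0).differentiable (by simp) (P q)).hasFDerivAt.comp q P.hasFDerivAt
    rw [show f = (fun q => j q 0) ∘ P from rfl, h.fderiv]
    simp [P, hx0]
  let R := primitive x₁ (e 0) ρ
  let T := primitive time (1, 0) f
  let J : Fin 3 → Pt → ℝ := fun k => primitive x₁ (e 0) fun q => j q k
  have hR : ContDiff ℝ (⊤ : ℕ∞) R := contDiff_primitive _ _ hρ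
  have hT : ContDiff ℝ (⊤ : ℕ∞) T := contDiff_primitive _ _ hf
  have hJ : ∀ k, ContDiff ℝ (⊤ : ℕ∞) (J k) := fun k => contDiff_primitive _ _ (hjc k)
  have hE : ContDiff ℝ (⊤ : ℕ∞) fun p => (![R p - T p, 0, 0] : Fin 3 → ℝ) := by
    refine contDiff_pi.2 fun k => ?_
    fin_cases k
    exacts [hR.sub hT, contDiff_const, contDiff_const]
  have hB : ContDiff ℝ (⊤ : ℕ∞) fun p => (![0, J 2 p, -J 1 p] : Fin 3 → ℝ) := by
    refine contDiff_pi.2 fun k => ?_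
    fin_cases k
    exacts [contDiff_const, hJ 2, (hJ 1).neg]
  have hRT : ∀ p w, fderiv ℝ (fun q => R q - T q) p w = fderiv ℝ R p w - fderiv ℝ T p w := by
    intro p w
    rw [fderiv_fun_sub (hR.differentiable (by simp) p) (hT.differentiable (by simp) p)]
    rfl
  have hEc := fun p => fderiv_apply_component (hE.differentiable (by simp) p)
  have hBc := fun p => fderiv_apply_component (hB.differentiable (by simp) p)
  have hT0 : ∀ p, fderiv ℝ T p (e 0) = 0 := by
    intro p
    rw [fderiv_primitive_of_apply_eq_zero ht0 hf]
    simp [hf0, primitive]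
  have hdiv : ∀ q, fderiv ℝ ρ q (1, 0) = -(fderiv ℝ (fun q => j q 0) q (e 0) +
      fderiv ℝ (fun q => j q 1) q (e 1) + fderiv ℝ (fun q => j q 2) q (e 2)) := by
    intro q
    have h := hcont q
    simp only [timeDeriv, div3, spaceDeriv, Fin.sum_univ_three,
      fderiv_apply_component (hj.differentiable (by simp) q)] at h
    exact eq_neg_of_add_eq_zero_left h
  have hjd : ∀ k w, Continuous fun q => fderiv ℝ (fun q => j q k) q w := fun k w =>
    ((hjc k).continuous_fderiv (by simp)).clm_apply continuous_const
  have hRt : ∀ p, fderiv ℝ R p (1, 0) =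
      -(j p 0 - f p + fderiv ℝ (J 1) p (e 1) + fderiv ℝ (J 2) p (e 2)) := by
    intro p
    rw [fderiv_primitive_of_apply_eq_zero hxt hρ, fderiv_primitive_of_apply_eq_zero hx1 (hjc 1),
      fderiv_primitive_of_apply_eq_zero hx2 (hjc 2), funext hdiv, primitive_neg,
      primitive_add ((hjd 0 _).fun_add (hjd 1 _)) (hjd 2 _), primitive_add (hjd 0 _) (hjd 1 _),
      primitive_fderiv_self (hjc 0)]
    rfl
  refine ⟨_, _, hE, hB, fun p => ?_, fun p => ?_⟩
  · simp only [div3, spaceDeriv, Fin.sum_univ_three, hEc]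
    simp only [Matrix.cons_val, fderiv_fun_const, Pi.zero_apply, zero_apply, add_zero, hRT]
    exact (congrArg₂ _ (fderiv_primitive_self hx0 hρ p) (hT0 p)).trans (sub_zero _)
  · have hJ0 : ∀ k, fderiv ℝ (J k) p (e 0) = j p k := fun k =>
      fderiv_primitive_self hx0 (hjc k) p
    have hTt : fderiv ℝ T p (1, 0) = f p := fderiv_primitive_self htt hf p
    have hRp := hRt p
    ext k
    fin_cases k <;>
      simp only [timeDeriv, curl3, spaceDeriv, Pi.add_apply, Pi.neg_apply, hEc, hBc,
        Fin.mk_one, Fin.zero_eta, Fin.reduceFinMk, Matrix.cons_val, fderiv_fun_const,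
        fderiv_fun_neg, neg_apply, Pi.zero_apply, zero_apply, hRT]
    · change -(fderiv ℝ R p (1, 0) - fderiv ℝ T p (1, 0)) +
        (-fderiv ℝ (J 1) p (e 1) - fderiv ℝ (J 2) p (e 2)) = j p 0
      linarith
    · rw [← hJ0 1]
      simp [e]
    · rw [← hJ0 2]
      simp [e]

end
end

section
/- Let ρ : ℝ⁴ → ℝ and j : ℝ⁴ → ℝ³ be smooth (coordinates (t,x) with x ∈ ℝ³) satisfying the continuity equation ∂_tρ + div j = 0 everywhere. Then there exist smooth maps V : ℝ⁴ → ℝ and A : ℝ⁴ → ℝ³ satisfying the Lorenz gauge condition ∂_tV + div A = 0 together with the wave equations ∂_t²V − ΔV = ρ and ∂_t²A − ΔA = j everywhere (Δ being the spatial Laplacian, acting componentwise on A); consequently the fields E := −∂_tA − grad V and B := curl A satisfy div E = ρ and −∂_tE + curl B = j. -/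
noncomputable section

variable {E : Type*} [NormedAddCommGroup E] [NormedSpace ℝ E]

section ParametricIntegral

open MeasureTheory Set

variable {P G : Type} [NormedAddCommGroup P] [NormedSpace ℝ P] [FiniteDimensional ℝ P]
  [NormedAddCommGroup G] [NormedSpace ℝ G]

theorem hasFDerivAt_intervalIntegral_param {f : P × ℝ → G} (hf : ContDiff ℝ 1 f) (a b : ℝ)
    (x : P) :
    HasFDerivAt (fun y => ∫ s in a..b, f (y, s))
      (∫ s in a..b, (fderiv ℝ f (x, s)).comp (ContinuousLinearMap.inl ℝ P ℝ)) x := by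
  have : ProperSpace P := FiniteDimensional.proper ℝ P
  have hc : Continuous fun z : P × ℝ =>
      (fderiv ℝ f z).comp (ContinuousLinearMap.inl ℝ P ℝ) :=
    (hf.continuous_fderiv one_ne_zero).clm_comp continuous_const
  obtain ⟨C, hC⟩ := ((isCompact_closedBall x 1).prod
    (isCompact_uIcc (a := a) (b := b))).exists_bound_of_continuousOn hc.continuousOn
  refine intervalIntegral.hasFDerivAt_integral_of_dominated_of_fderiv_le (𝕜 := ℝ)
    (F' := fun y s => (fderiv ℝ f (y, s)).comp (ContinuousLinearMap.inl ℝ P ℝ))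
    (bound := fun _ => C) (Metric.ball_mem_nhds x one_pos) ?_ ?_ ?_ ?_ ?_ ?_
  · exact .of_forall fun y =>
      (hf.continuous.comp (by fun_prop : Continuous fun s : ℝ => (y, s))).aestronglyMeasurable
  · exact (hf.continuous.comp (by fun_prop : Continuous fun s : ℝ => (x, s))).intervalIntegrable _ _
  · exact (hc.comp (by fun_prop : Continuous fun s : ℝ => (x, s))).aestronglyMeasurable
  · exact .of_forall fun s hs y hy =>
      hC (y, s) ⟨Metric.ball_subset_closedBall hy, uIoc_subset_uIcc hs⟩
  · exact intervalIntegrable_const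
  · refine .of_forall fun s _ y _ => ?_
    exact ((hf.differentiable one_ne_zero) (y, s)).hasFDerivAt.comp y
      (hasFDerivAt_prodMk_left y s)

theorem fderiv_intervalIntegral_param [CompleteSpace G] {f : P × ℝ → G}
    (hf : ContDiff ℝ 1 f) (a b : ℝ) (x v : P) :
    fderiv ℝ (fun y => ∫ s in a..b, f (y, s)) x v = ∫ s in a..b, fderiv ℝ f (x, s) (v, 0) := by
  have hc : Continuous fun s : ℝ =>
      (fderiv ℝ f (x, s)).comp (ContinuousLinearMap.inl ℝ P ℝ) :=
    ((hf.continuous_fderiv one_ne_zero).comp (by fun_prop)).clm_comp continuous_const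
  rw [(hasFDerivAt_intervalIntegral_param hf a b x).fderiv,
    ContinuousLinearMap.intervalIntegral_apply (hc.intervalIntegrable _ _)]
  simp

theorem contDiff_intervalIntegral_param_nat (n : ℕ) (a b : ℝ) :
    ∀ {G : Type} [NormedAddCommGroup G] [NormedSpace ℝ G] {f : P × ℝ → G},
      ContDiff ℝ n f → ContDiff ℝ n fun y => ∫ s in a..b, f (y, s) := by
  induction n with
  | zero =>
    intro G _ _ f hf
    simp only [CharP.cast_eq_zero, contDiff_zero] at hf ⊢
    exact intervalIntegral.continuous_parametric_intervalIntegral_of_continuous' (by fun_prop) a b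
  | succ n ih =>
    intro G _ _ f hf
    have h1 : ContDiff ℝ 1 f := hf.of_le (by norm_cast; omega)
    push_cast at hf ⊢
    refine (contDiff_succ_iff_hasFDerivAt).2 ⟨_, ?_, hasFDerivAt_intervalIntegral_param h1 a b⟩
    exact ih (f := fun z => (fderiv ℝ f z).comp (ContinuousLinearMap.inl ℝ P ℝ))
      ((hf.fderiv_right le_rfl).clm_comp contDiff_const)

theorem contDiff_intervalIntegral_param {f : P × ℝ → G} (hf : ContDiff ℝ (⊤ : ℕ∞) f) (a b : ℝ) :
    ContDiff ℝ (⊤ : ℕ∞) fun y => ∫ s in a..b, f (y, s) :=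
  contDiff_infty.2 fun n => contDiff_intervalIntegral_param_nat n a b (contDiff_infty.1 hf n)

/-- The partial derivative in the parameter and the fundamental theorem of calculus combined. -/
theorem contDiff_and_fderiv_integral_upper {f : P × ℝ → ℝ} (hf : ContDiff ℝ (⊤ : ℕ∞) f) :
    ContDiff ℝ (⊤ : ℕ∞) (fun z : P × ℝ => ∫ s in (0 : ℝ)..z.2, f (z.1, s)) ∧
    ∀ (x w : P) (a c : ℝ), fderiv ℝ (fun z : P × ℝ => ∫ s in (0 : ℝ)..z.2, f (z.1, s)) (x, a) (w, c)
      = c * f (x, a) + ∫ s in (0 : ℝ)..a, fderiv ℝ f (x, s) (w, 0) := by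
  have hs : ContDiff ℝ (⊤ : ℕ∞) (fun z : P × ℝ => ∫ s in (0 : ℝ)..z.2, f (z.1, s)) := by
    have : (fun z : P × ℝ => ∫ s in (0 : ℝ)..z.2, f (z.1, s)) =
        fun z => ∫ s in (0 : ℝ)..1, z.2 * f (z.1, z.2 * s) := by
      funext z
      rw [intervalIntegral.integral_const_mul,
        intervalIntegral.mul_integral_comp_mul_left (f := fun s => f (z.1, s))]
      simp
    rw [this]
    exact contDiff_intervalIntegral_param
      (f := fun y : (P × ℝ) × ℝ => y.1.2 * f (y.1.1, y.1.2 * y.2)) (by fun_prop) 0 1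
  refine ⟨hs, fun x w a c => ?_⟩
  have hd := (hs.differentiable (by simp) (x, a)).hasFDerivAt
  have h1 : fderiv ℝ (fun z : P × ℝ => ∫ s in (0 : ℝ)..z.2, f (z.1, s)) (x, a) (w, 0) =
      ∫ s in (0 : ℝ)..a, fderiv ℝ f (x, s) (w, 0) := by
    have h := hasFDerivAt_intervalIntegral_param (hf.of_le (by simp)) 0 a x
    have hl := hd.comp x (f := fun y : P => (y, a)) (hasFDerivAt_prodMk_left x a)
    rw [← fderiv_intervalIntegral_param (hf.of_le (by simp)) 0 a x w, h.fderiv, ← hl.unique h]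
    simp
  have h2 : fderiv ℝ (fun z : P × ℝ => ∫ s in (0 : ℝ)..z.2, f (z.1, s)) (x, a) (0, 1) =
      f (x, a) := by
    have hline : HasDerivAt (fun t : ℝ => (x, t)) (0, 1) a :=
      (hasDerivAt_const a x).prodMk (hasDerivAt_id a)
    refine (hd.comp_hasDerivAt a hline).unique ?_
    have hcont : Continuous fun s => f (x, s) := by fun_prop
    exact intervalIntegral.integral_hasDerivAt_right (hcont.intervalIntegrable _ _)
      hcont.aestronglyMeasurable.stronglyMeasurableAtFilter hcont.continuousAt
  have : ((w, c) : P × ℝ) = (w, 0) + c • (0, 1) := by simp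
  rw [this, map_add, map_smul, h1, h2, smul_eq_mul, add_comm]

end ParametricIntegral

/-- The retarded integral `∫₀ᵗ K (t - τ, (τ, x)) dτ`. -/
def duhamel (K : ℝ × Pt → ℝ) (p : Pt) : ℝ := ∫ τ in (0 : ℝ)..p.1, K (p.1 - τ, (τ, p.2))

theorem contDiff_fderiv_apply {P : Type*} [NormedAddCommGroup P] [NormedSpace ℝ P]
    {f : P → ℝ} (hf : ContDiff ℝ (⊤ : ℕ∞) f) (v : P) :
    ContDiff ℝ (⊤ : ℕ∞) fun q => fderiv ℝ f q v :=
  (hf.fderiv_right (by simp)).clm_apply contDiff_const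

theorem contDiff_timeDeriv {f : Pt → ℝ} (hf : ContDiff ℝ (⊤ : ℕ∞) f) :
    ContDiff ℝ (⊤ : ℕ∞) (timeDeriv f) :=
  contDiff_fderiv_apply hf _

theorem contDiff_spaceDeriv {f : Pt → ℝ} (hf : ContDiff ℝ (⊤ : ℕ∞) f) (i : Fin 3) :
    ContDiff ℝ (⊤ : ℕ∞) (spaceDeriv i f) :=
  contDiff_fderiv_apply hf _

theorem fderiv_apply_eq_of_line {P : Type*} [NormedAddCommGroup P] [NormedSpace ℝ P]
    {f : P → ℝ} (hf : Differentiable ℝ f) {q v : P} {γ : ℝ → P} {t c : ℝ} (hγ : HasDerivAt γ v t)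
    (hq : γ t = q) (h : HasDerivAt (fun s => f (γ s)) c t) : fderiv ℝ f q v = c := by
  subst hq
  exact ((hf (γ t)).hasFDerivAt.comp_hasDerivAt t hγ).unique h

theorem fderiv_duhamel {K : ℝ × Pt → ℝ} (hK : ContDiff ℝ (⊤ : ℕ∞) K) :
    ContDiff ℝ (⊤ : ℕ∞) (duhamel K) ∧ ∀ (p : Pt) (a : ℝ) (v : Fin 3 → ℝ),
      fderiv ℝ (duhamel K) p (a, v) =
        a * K (0, p) + duhamel (fun q => fderiv ℝ K q (a, (0, v))) p := by
  let f : Pt × ℝ → ℝ := fun z => K (z.1.1 - z.2, (z.2, z.1.2))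
  have hf : ContDiff ℝ (⊤ : ℕ∞) f := by fun_prop
  obtain ⟨h1, h2⟩ := contDiff_and_fderiv_integral_upper hf
  have hc : ContDiff ℝ (⊤ : ℕ∞) fun p : Pt => (p, p.1) := by fun_prop
  refine ⟨h1.comp hc, fun p a v => ?_⟩
  have hline : HasFDerivAt (fun p : Pt => (p, p.1))
      ((ContinuousLinearMap.id ℝ Pt).prod (ContinuousLinearMap.fst ℝ ℝ (Fin 3 → ℝ))) p :=
    (hasFDerivAt_id p).prodMk hasFDerivAt_fst
  have h3 := ((h1.differentiable (by simp) (p, p.1)).hasFDerivAt.comp p hline).fderiv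
  have h4 : fderiv ℝ (duhamel K) p (a, v) = _ := congrArg (fun L => L (a, v)) h3
  rw [h4]
  simp only [ContinuousLinearMap.comp_apply, ContinuousLinearMap.prod_apply,
    ContinuousLinearMap.id_apply, ContinuousLinearMap.coe_fst']
  rw [h2]
  congr 1
  · simp [f]
  · refine intervalIntegral.integral_congr fun s _ => ?_
    let M : Pt × ℝ →L[ℝ] ℝ × Pt :=
      (((ContinuousLinearMap.fst ℝ ℝ (Fin 3 → ℝ)).comp (ContinuousLinearMap.fst ℝ Pt ℝ)) -
        ContinuousLinearMap.snd ℝ Pt ℝ).prod ((ContinuousLinearMap.snd ℝ Pt ℝ).prod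
        ((ContinuousLinearMap.snd ℝ ℝ (Fin 3 → ℝ)).comp (ContinuousLinearMap.fst ℝ Pt ℝ)))
    have hg : HasFDerivAt (fun z : Pt × ℝ => ((z.1.1 - z.2, (z.2, z.1.2)) : ℝ × Pt)) M (p, s) :=
      M.hasFDerivAt
    have h5 := ((hK.differentiable (by simp) _).hasFDerivAt.comp (p, s) hg).fderiv
    have h6 := congrArg (fun L => L ((a, v), (0 : ℝ))) h5
    simpa [f, M, Function.comp_def] using h6

/-- Duhamel's principle. -/
theorem exists_wave_solution_of_propagator {f : Pt → ℝ} {K : ℝ × Pt → ℝ}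
    (hK : ContDiff ℝ (⊤ : ℕ∞) K) (h0 : ∀ p, K (0, p) = 0)
    (h1 : ∀ p, fderiv ℝ K (0, p) (1, 0) = f p)
    (h2 : ∀ q, fderiv ℝ (fun q => fderiv ℝ K q (1, 0)) q (1, 0) =
      ∑ i : Fin 3, fderiv ℝ (fun q => fderiv ℝ K q (0, (0, Pi.single i 1))) q
        (0, (0, Pi.single i 1))) :
    ∃ u : Pt → ℝ, ContDiff ℝ (⊤ : ℕ∞) u ∧
      ∀ p, timeDeriv (timeDeriv u) p - lap3 u p = f p := by
  refine ⟨duhamel K, (fderiv_duhamel hK).1, fun p => ?_⟩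
  have ht : timeDeriv (duhamel K) = duhamel (fun q => fderiv ℝ K q (1, 0)) := by
    funext p
    exact ((fderiv_duhamel hK).2 p 1 0).trans (by rw [h0, mul_zero, zero_add]; rfl)
  have hx (i : Fin 3) : spaceDeriv i (duhamel K) =
      duhamel (fun q => fderiv ℝ K q (0, (0, Pi.single i 1))) := by
    funext p
    exact ((fderiv_duhamel hK).2 p 0 _).trans (by rw [zero_mul, zero_add])
  have htt := (fderiv_duhamel (contDiff_fderiv_apply hK (1, 0))).2 p 1 0
  have hxx (i : Fin 3) := (fderiv_duhamel
    (contDiff_fderiv_apply hK (0, (0, Pi.single i 1)))).2 p 0 (Pi.single i 1)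
  unfold lap3
  simp only [ht, hx]
  simp only [timeDeriv, spaceDeriv]
  rw [htt, Finset.sum_congr rfl fun i _ => hxx i, one_mul, h1]
  simp only [zero_mul, zero_add]
  have hsum : duhamel (fun q => fderiv ℝ (fun q => fderiv ℝ K q (1, 0)) q (1, (0, 0))) p =
      ∑ i : Fin 3, duhamel (fun q => fderiv ℝ (fun q => fderiv ℝ K q (0, (0, Pi.single i 1))) q
        (0, (0, Pi.single i 1))) p := by
    unfold duhamel
    rw [← intervalIntegral.integral_finsetSum]
    · exact intervalIntegral.integral_congr fun s _ => h2 _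
    · intro i _
      have := (contDiff_fderiv_apply (contDiff_fderiv_apply hK (0, (0, Pi.single i 1)))
        (0, (0, Pi.single i 1))).continuous
      exact Continuous.intervalIntegrable (this.comp (by fun_prop)) _ _
  rw [hsum]
  ring

theorem fderiv_fderiv_apply_comm {P : Type*} [NormedAddCommGroup P] [NormedSpace ℝ P]
    {f : P → ℝ} (hf : ContDiff ℝ (⊤ : ℕ∞) f) (v w p : P) :
    fderiv ℝ (fun q => fderiv ℝ f q v) p w = fderiv ℝ (fun q => fderiv ℝ f q w) p v := by
  have hd : DifferentiableAt ℝ (fderiv ℝ f) p :=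
    (hf.fderiv_right (m := (⊤ : ℕ∞)) (by simp)).differentiable (by simp) p
  have h2 : (2 : WithTop ℕ∞) ≤ ((⊤ : ℕ∞) : WithTop ℕ∞) := WithTop.coe_le_coe.2 le_top
  rw [fderiv_clm_apply hd (differentiableAt_const v),
    fderiv_clm_apply hd (differentiableAt_const w)]
  simpa using (hf.contDiffAt.isSymmSndFDerivAt (by simpa using h2)).eq w v

/-- The point `(t, x + s ω)` where `ω` has spherical coordinates `(φ, θ)`; the argument is
`(((s, (t, x)), φ), θ)`. -/
def sphPt (z : ((ℝ × Pt) × ℝ) × ℝ) : Pt :=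
  (z.1.1.2.1, ![z.1.1.2.2 0 + z.1.1.1 * (Real.sin z.1.2 * Real.cos z.2),
    z.1.1.2.2 1 + z.1.1.1 * (Real.sin z.1.2 * Real.sin z.2),
    z.1.1.2.2 2 + z.1.1.1 * Real.cos z.1.2])

theorem contDiff_sphPt : ContDiff ℝ (⊤ : ℕ∞) sphPt := by
  unfold sphPt
  refine ContDiff.prodMk (by fun_prop) (contDiff_pi.2 fun i => ?_)
  fin_cases i <;> simp <;> fun_prop

theorem hasDerivAt_comp_space {f : Pt → ℝ} (hf : ContDiff ℝ (⊤ : ℕ∞) f) {t r a' b' c' : ℝ}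
    {γ : ℝ → Pt} {x : Pt} (hx : γ t = x) (ha : HasDerivAt (fun s => (γ s).2 0) a' t)
    (hb : HasDerivAt (fun s => (γ s).2 1) b' t) (hc : HasDerivAt (fun s => (γ s).2 2) c' t)
    (h0 : ∀ s, (γ s).1 = r) :
    HasDerivAt (fun s => f (γ s))
      (a' * spaceDeriv 0 f x + b' * spaceDeriv 1 f x + c' * spaceDeriv 2 f x) t := by
  subst hx
  have hγ : HasDerivAt γ (0, ![a', b', c']) t := by
    have h1 : HasDerivAt (fun s => (γ s).1) 0 t := by simpa [h0] using hasDerivAt_const t r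
    have h2 : HasDerivAt (fun s => (γ s).2) ![a', b', c'] t := by
      rw [hasDerivAt_pi]
      intro i
      fin_cases i <;> assumption
    exact h1.prodMk h2
  have h := (hf.differentiable (by simp) (γ t)).hasFDerivAt.comp_hasDerivAt t hγ
  have hv : ((0, ![a', b', c']) : Pt) = a' • ((0, Pi.single 0 1) : Pt) +
      b' • ((0, Pi.single 1 1) : Pt) + c' • ((0, Pi.single 2 1) : Pt) := by
    refine Prod.ext (by simp) (funext fun i => ?_)
    fin_cases i <;> simp
  rw [hv, map_add, map_add, map_smul, map_smul, map_smul] at h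
  exact h

/-- Double integral over the rectangle `[0, π] × [0, 2π]`. -/
def sphInt (K : ((ℝ × Pt) × ℝ) × ℝ → ℝ) (q : ℝ × Pt) : ℝ :=
  ∫ φ in (0 : ℝ)..Real.pi, ∫ θ in (0 : ℝ)..2 * Real.pi, K ((q, φ), θ)

theorem contDiff_sphInt {K : ((ℝ × Pt) × ℝ) × ℝ → ℝ} (hK : ContDiff ℝ (⊤ : ℕ∞) K) :
    ContDiff ℝ (⊤ : ℕ∞) (sphInt K) :=
  contDiff_intervalIntegral_param
    (f := fun y : (ℝ × Pt) × ℝ => ∫ θ in (0 : ℝ)..2 * Real.pi, K (y, θ))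
    (contDiff_intervalIntegral_param hK _ _) _ _

theorem fderiv_sphInt {K : ((ℝ × Pt) × ℝ) × ℝ → ℝ} (hK : ContDiff ℝ (⊤ : ℕ∞) K) (q v : ℝ × Pt) :
    fderiv ℝ (sphInt K) q v = sphInt (fun z => fderiv ℝ K z ((v, 0), 0)) q := by
  have h1 := contDiff_intervalIntegral_param hK 0 (2 * Real.pi)
  unfold sphInt
  rw [fderiv_intervalIntegral_param
    (f := fun y : (ℝ × Pt) × ℝ => ∫ θ in (0 : ℝ)..2 * Real.pi, K (y, θ)) (h1.of_le (by simp))]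
  refine intervalIntegral.integral_congr fun s _ => ?_
  exact fderiv_intervalIntegral_param (hK.of_le (by simp)) _ _ _ _

/-- The integrand of `s` times the spherical mean. -/
def sphKer (f : Pt → ℝ) (z : ((ℝ × Pt) × ℝ) × ℝ) : ℝ :=
  z.1.1.1 * Real.sin z.1.2 * f (sphPt z)

/-- The derivative of `f (x + s ω)` in `s`. -/
def radDeriv (f : Pt → ℝ) (z : ((ℝ × Pt) × ℝ) × ℝ) : ℝ :=
  Real.sin z.1.2 * Real.cos z.2 * spaceDeriv 0 f (sphPt z) +
    Real.sin z.1.2 * Real.sin z.2 * spaceDeriv 1 f (sphPt z) +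
    Real.cos z.1.2 * spaceDeriv 2 f (sphPt z)

theorem contDiff_sphKer {f : Pt → ℝ} (hf : ContDiff ℝ (⊤ : ℕ∞) f) :
    ContDiff ℝ (⊤ : ℕ∞) (sphKer f) := by
  have h : ContDiff ℝ (⊤ : ℕ∞) fun z => f (sphPt z) := hf.comp contDiff_sphPt
  exact ContDiff.mul (by fun_prop) h

theorem contDiff_radDeriv {f : Pt → ℝ} (hf : ContDiff ℝ (⊤ : ℕ∞) f) :
    ContDiff ℝ (⊤ : ℕ∞) (radDeriv f) := by
  have h (i : Fin 3) : ContDiff ℝ (⊤ : ℕ∞) fun z => spaceDeriv i f (sphPt z) :=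
    (contDiff_spaceDeriv hf i).comp contDiff_sphPt
  exact ((ContDiff.mul (by fun_prop) (h 0)).add (ContDiff.mul (by fun_prop) (h 1))).add
    (ContDiff.mul (by fun_prop) (h 2))

theorem hasDerivAt_rad {f : Pt → ℝ} (hf : ContDiff ℝ (⊤ : ℕ∞) f) (s : ℝ) (p : Pt) (φ θ : ℝ) :
    HasDerivAt (fun s => f (sphPt (((s, p), φ), θ))) (radDeriv f (((s, p), φ), θ)) s := by
  refine hasDerivAt_comp_space hf (r := p.1) rfl ?_ ?_ ?_ fun _ => rfl
  · simpa [sphPt] using ((hasDerivAt_id s).mul_const (Real.sin φ * Real.cos θ)).const_add (p.2 0)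
  · simpa [sphPt] using ((hasDerivAt_id s).mul_const (Real.sin φ * Real.sin θ)).const_add (p.2 1)
  · simpa [sphPt] using ((hasDerivAt_id s).mul_const (Real.cos φ)).const_add (p.2 2)

theorem fderiv_time_of_hasDerivAt {K : ((ℝ × Pt) × ℝ) × ℝ → ℝ} (hK : ContDiff ℝ (⊤ : ℕ∞) K)
    {s c φ θ : ℝ} {p : Pt} (h : HasDerivAt (fun s => K (((s, p), φ), θ)) c s) :
    fderiv ℝ K (((s, p), φ), θ) ((((1, 0) : ℝ × Pt), (0 : ℝ)), (0 : ℝ)) = c :=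
  fderiv_apply_eq_of_line (hK.differentiable (by simp)) (γ := fun s => (((s, p), φ), θ))
    ((((hasDerivAt_id s).prodMk (hasDerivAt_const s p)).prodMk
      (hasDerivAt_const s φ)).prodMk (hasDerivAt_const s θ)) rfl h

theorem fderiv_sphKer_time {f : Pt → ℝ} (hf : ContDiff ℝ (⊤ : ℕ∞) f) :
    (fun z => fderiv ℝ (sphKer f) z ((((1, 0) : ℝ × Pt), (0 : ℝ)), (0 : ℝ))) =
      fun z => Real.sin z.1.2 * f (sphPt z) + z.1.1.1 * Real.sin z.1.2 * radDeriv f z := by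
  funext ⟨⟨⟨s, p⟩, φ⟩, θ⟩
  refine fderiv_time_of_hasDerivAt (contDiff_sphKer hf) ?_
  simpa [sphKer, Function.comp_def, Pi.mul_def] using
    ((hasDerivAt_id s).mul_const (Real.sin φ)).mul (hasDerivAt_rad hf s p φ θ)

theorem fderiv_sphKer_space {f : Pt → ℝ} (hf : ContDiff ℝ (⊤ : ℕ∞) f) (i : Fin 3) :
    (fun z => fderiv ℝ (sphKer f) z ((((0, (0, Pi.single i 1)) : ℝ × Pt), (0 : ℝ)), (0 : ℝ))) =
      sphKer (spaceDeriv i f) := by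
  funext ⟨⟨⟨s, p⟩, φ⟩, θ⟩
  have hp : HasDerivAt (fun t : ℝ => p + t • ((0, Pi.single i 1) : Pt)) (0, Pi.single i 1) 0 := by
    simpa using ((hasDerivAt_id (0 : ℝ)).smul_const ((0, Pi.single i 1) : Pt)).const_add p
  refine fderiv_apply_eq_of_line ((contDiff_sphKer hf).differentiable (by simp))
    (((((hasDerivAt_const (0 : ℝ) s).prodMk hp).prodMk
      (hasDerivAt_const 0 φ)).prodMk (hasDerivAt_const 0 θ))) (by simp) ?_
  have h := hasDerivAt_comp_space hf (r := p.1) (t := 0) (x := sphPt (((s, p), φ), θ))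
    (γ := fun t => sphPt (((s, p + t • ((0, Pi.single i 1) : Pt)), φ), θ)) (by simp)
    (by simpa [sphPt] using hasDerivAt_mul_const _) (by simpa [sphPt] using hasDerivAt_mul_const _)
    (by simpa [sphPt] using hasDerivAt_mul_const _) (by simp [sphPt])
  have h' := h.const_mul (s * Real.sin φ)
  refine h'.congr_deriv ?_
  fin_cases i <;> simp [sphKer]

theorem spaceDeriv_comm {f : Pt → ℝ} (hf : ContDiff ℝ (⊤ : ℕ∞) f) (i j : Fin 3) (p : Pt) :
    spaceDeriv i (spaceDeriv j f) p = spaceDeriv j (spaceDeriv i f) p :=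
  fderiv_fderiv_apply_comm hf _ _ _

theorem spaceDeriv_timeDeriv_comm {f : Pt → ℝ} (hf : ContDiff ℝ (⊤ : ℕ∞) f) (i : Fin 3) (p : Pt) :
    spaceDeriv i (timeDeriv f) p = timeDeriv (spaceDeriv i f) p :=
  fderiv_fderiv_apply_comm hf _ _ _

/-- A flux over the rectangle `[0, π] × [0, 2π]` vanishes if the first component vanishes on the
corresponding sides and the second one is periodic. -/
theorem integral_flux_eq_zero {X Y : ℝ × ℝ → ℝ} (hX : ContDiff ℝ (⊤ : ℕ∞) X)
    (hY : ContDiff ℝ (⊤ : ℕ∞) Y) (hX0 : ∀ θ, X (0, θ) = 0) (hXπ : ∀ θ, X (Real.pi, θ) = 0)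
    (hY2π : ∀ φ, Y (φ, 2 * Real.pi) = Y (φ, 0)) :
    ∫ φ in (0 : ℝ)..Real.pi, ∫ θ in (0 : ℝ)..2 * Real.pi,
      (fderiv ℝ X (φ, θ) (1, 0) + fderiv ℝ Y (φ, θ) (0, 1)) = 0 := by
  have hXc := (contDiff_fderiv_apply hX (1, 0)).continuous
  have hYc := (contDiff_fderiv_apply hY (0, 1)).continuous
  have hYint (φ : ℝ) : ∫ θ in (0 : ℝ)..2 * Real.pi, fderiv ℝ Y (φ, θ) (0, 1) = 0 := by
    rw [intervalIntegral.integral_eq_sub_of_hasDerivAt (f := fun θ => Y (φ, θ)), hY2π, sub_self]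
    · intro θ _
      exact (hY.differentiable (by simp) (φ, θ)).hasFDerivAt.comp_hasDerivAt θ
        ((hasDerivAt_const θ φ).prodMk (hasDerivAt_id θ))
    · exact Continuous.intervalIntegrable (hYc.comp (by fun_prop)) _ _
  have hZ := contDiff_intervalIntegral_param hX 0 (2 * Real.pi)
  have hsplit (φ : ℝ) : ∫ θ in (0 : ℝ)..2 * Real.pi,
      (fderiv ℝ X (φ, θ) (1, 0) + fderiv ℝ Y (φ, θ) (0, 1)) =
      fderiv ℝ (fun φ => ∫ θ in (0 : ℝ)..2 * Real.pi, X (φ, θ)) φ 1 := by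
    rw [intervalIntegral.integral_add, hYint, add_zero,
      fderiv_intervalIntegral_param (hX.of_le (by simp))]
    · exact Continuous.intervalIntegrable (hXc.comp (by fun_prop)) _ _
    · exact Continuous.intervalIntegrable (hYc.comp (by fun_prop)) _ _
  simp only [hsplit]
  rw [intervalIntegral.integral_eq_sub_of_hasDerivAt
    (f := fun φ => ∫ θ in (0 : ℝ)..2 * Real.pi, X (φ, θ))]
  · simp [hX0, hXπ]
  · intro φ _
    exact (hZ.differentiable (by simp) φ).hasFDerivAt.hasDerivAt
  · exact (contDiff_fderiv_apply hZ 1).continuous.intervalIntegrable _ _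

/-- The second derivative of `s f (x + s ω)` in `s`, times the density of the sphere. -/
def radKer (f : Pt → ℝ) (z : ((ℝ × Pt) × ℝ) × ℝ) : ℝ :=
  2 * Real.sin z.1.2 * radDeriv f z + z.1.1.1 * Real.sin z.1.2 *
    (Real.sin z.1.2 * Real.cos z.2 * radDeriv (spaceDeriv 0 f) z +
      Real.sin z.1.2 * Real.sin z.2 * radDeriv (spaceDeriv 1 f) z +
      Real.cos z.1.2 * radDeriv (spaceDeriv 2 f) z)

theorem hasDerivAt_polar {f : Pt → ℝ} (hf : ContDiff ℝ (⊤ : ℕ∞) f) (q : ℝ × Pt) (φ θ : ℝ) :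
    HasDerivAt (fun φ => f (sphPt ((q, φ), θ)))
      (q.1 * (Real.cos φ * Real.cos θ) * spaceDeriv 0 f (sphPt ((q, φ), θ)) +
        q.1 * (Real.cos φ * Real.sin θ) * spaceDeriv 1 f (sphPt ((q, φ), θ)) +
        q.1 * (-Real.sin φ) * spaceDeriv 2 f (sphPt ((q, φ), θ))) φ := by
  refine hasDerivAt_comp_space hf (r := q.2.1) rfl ?_ ?_ ?_ fun _ => rfl
  · simpa [sphPt] using
      (((Real.hasDerivAt_sin φ).mul_const (Real.cos θ)).const_mul q.1).const_add (q.2.2 0)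
  · simpa [sphPt] using
      (((Real.hasDerivAt_sin φ).mul_const (Real.sin θ)).const_mul q.1).const_add (q.2.2 1)
  · simpa [sphPt] using ((Real.hasDerivAt_cos φ).const_mul q.1).const_add (q.2.2 2)

theorem hasDerivAt_azimuth {f : Pt → ℝ} (hf : ContDiff ℝ (⊤ : ℕ∞) f) (q : ℝ × Pt) (φ θ : ℝ) :
    HasDerivAt (fun θ => f (sphPt ((q, φ), θ)))
      (q.1 * (Real.sin φ * -Real.sin θ) * spaceDeriv 0 f (sphPt ((q, φ), θ)) +
        q.1 * (Real.sin φ * Real.cos θ) * spaceDeriv 1 f (sphPt ((q, φ), θ)) +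
        0 * spaceDeriv 2 f (sphPt ((q, φ), θ))) θ := by
  refine hasDerivAt_comp_space hf (r := q.2.1) rfl ?_ ?_ ?_ fun _ => rfl
  · simpa [sphPt] using
      (((Real.hasDerivAt_cos θ).const_mul (Real.sin φ)).const_mul q.1).const_add (q.2.2 0)
  · simpa [sphPt] using
      (((Real.hasDerivAt_sin θ).const_mul (Real.sin φ)).const_mul q.1).const_add (q.2.2 1)
  · simpa [sphPt] using hasDerivAt_const θ _

/-- The spherical mean identity (Darboux): the difference of the integrands is an exact flux. -/
theorem sphInt_radKer {f : Pt → ℝ} (hf : ContDiff ℝ (⊤ : ℕ∞) f) (q : ℝ × Pt) :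
    sphInt (fun z => (∑ i : Fin 3, sphKer (spaceDeriv i (spaceDeriv i f)) z) - radKer f z) q =
      0 := by
  have hs : ContDiff ℝ (⊤ : ℕ∞) fun y : ℝ × ℝ => sphPt ((q, y.1), y.2) :=
    contDiff_sphPt.comp (by fun_prop)
  have hf' (i : Fin 3) : ContDiff ℝ (⊤ : ℕ∞) fun y : ℝ × ℝ =>
      spaceDeriv i f (sphPt ((q, y.1), y.2)) := (contDiff_spaceDeriv hf i).comp hs
  let X : ℝ × ℝ → ℝ := fun y => Real.sin y.1 *
    (Real.cos y.1 * Real.cos y.2 * spaceDeriv 0 f (sphPt ((q, y.1), y.2)) +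
      Real.cos y.1 * Real.sin y.2 * spaceDeriv 1 f (sphPt ((q, y.1), y.2)) -
      Real.sin y.1 * spaceDeriv 2 f (sphPt ((q, y.1), y.2)))
  let Y : ℝ × ℝ → ℝ := fun y =>
    Real.cos y.2 * spaceDeriv 1 f (sphPt ((q, y.1), y.2)) -
      Real.sin y.2 * spaceDeriv 0 f (sphPt ((q, y.1), y.2))
  have hX : ContDiff ℝ (⊤ : ℕ∞) X :=
    ContDiff.mul (by fun_prop) (((ContDiff.mul (by fun_prop) (hf' 0)).add
      (ContDiff.mul (by fun_prop) (hf' 1))).sub (ContDiff.mul (by fun_prop) (hf' 2)))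
  have hY : ContDiff ℝ (⊤ : ℕ∞) Y :=
    (ContDiff.mul (by fun_prop) (hf' 1)).sub (ContDiff.mul (by fun_prop) (hf' 0))
  have key := integral_flux_eq_zero hX hY (by simp [X]) (by simp [X]) (by simp [Y, sphPt])
  rw [← key]
  refine intervalIntegral.integral_congr fun φ _ => intervalIntegral.integral_congr fun θ _ => ?_
  have hA (i : Fin 3) := hasDerivAt_polar (contDiff_spaceDeriv hf i) q φ θ
  have hB (i : Fin 3) := hasDerivAt_azimuth (contDiff_spaceDeriv hf i) q φ θ
  have hsin := Real.hasDerivAt_sin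
  have hcos := Real.hasDerivAt_cos
  have dX := fderiv_apply_eq_of_line (hX.differentiable (by simp)) (q := (φ, θ))
    ((hasDerivAt_id φ).prodMk (hasDerivAt_const φ θ)) rfl
    ((hsin φ).mul (((((hcos φ).mul_const (Real.cos θ)).mul (hA 0)).add
      (((hcos φ).mul_const (Real.sin θ)).mul (hA 1))).sub ((hsin φ).mul (hA 2))))
  have dY := fderiv_apply_eq_of_line (hY.differentiable (by simp)) (q := (φ, θ))
    ((hasDerivAt_const θ φ).prodMk (hasDerivAt_id θ)) rfl
    (((hcos θ).mul (hB 1)).sub ((hsin θ).mul (hB 0)))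
  simp only [dX, dY, id_eq, Fin.sum_univ_three, sphKer, radKer, radDeriv]
  simp only [spaceDeriv_comm hf 1 0, spaceDeriv_comm hf 2 0, spaceDeriv_comm hf 2 1]
  have h1 := Real.sin_sq_add_cos_sq φ
  have h2 := Real.sin_sq_add_cos_sq θ
  generalize Real.sin φ = a at *
  generalize Real.cos φ = b at *
  generalize Real.sin θ = c at *
  generalize Real.cos θ = d at *
  generalize sphPt ((q, φ), θ) = P at *
  generalize spaceDeriv 0 (spaceDeriv 0 f) P = f00
  generalize spaceDeriv 0 (spaceDeriv 1 f) P = f01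
  generalize spaceDeriv 0 (spaceDeriv 2 f) P = f02
  generalize spaceDeriv 1 (spaceDeriv 1 f) P = f11
  generalize spaceDeriv 1 (spaceDeriv 2 f) P = f12
  generalize spaceDeriv 2 (spaceDeriv 2 f) P = f22
  generalize spaceDeriv 0 f P = f0
  generalize spaceDeriv 1 f P = f1
  generalize spaceDeriv 2 f P = f2
  clear hX hY key hA hB dX dY hsin hcos X Y hs hf'
  grind

theorem sphInt_add {K L : ((ℝ × Pt) × ℝ) × ℝ → ℝ} (hK : ContDiff ℝ (⊤ : ℕ∞) K)
    (hL : ContDiff ℝ (⊤ : ℕ∞) L) (q : ℝ × Pt) :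
    sphInt (fun z => K z + L z) q = sphInt K q + sphInt L q := by
  have h {M : ((ℝ × Pt) × ℝ) × ℝ → ℝ} (hM : ContDiff ℝ (⊤ : ℕ∞) M) (φ : ℝ) :
      IntervalIntegrable (fun θ => M ((q, φ), θ)) MeasureTheory.volume 0 (2 * Real.pi) :=
    Continuous.intervalIntegrable (hM.continuous.comp (by fun_prop)) _ _
  have h' {M : ((ℝ × Pt) × ℝ) × ℝ → ℝ} (hM : ContDiff ℝ (⊤ : ℕ∞) M) :
      IntervalIntegrable (fun φ => ∫ θ in (0 : ℝ)..2 * Real.pi, M ((q, φ), θ))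
        MeasureTheory.volume 0 Real.pi :=
    Continuous.intervalIntegrable
      ((contDiff_intervalIntegral_param hM 0 (2 * Real.pi)).continuous.comp
        (by fun_prop : Continuous fun φ : ℝ => (q, φ))) _ _
  unfold sphInt
  rw [← intervalIntegral.integral_add (h' hK) (h' hL)]
  exact intervalIntegral.integral_congr fun φ _ => intervalIntegral.integral_add (h hK φ) (h hL φ)

theorem contDiff_radKer {f : Pt → ℝ} (hf : ContDiff ℝ (⊤ : ℕ∞) f) :
    ContDiff ℝ (⊤ : ℕ∞) (radKer f) := by
  have h (i : Fin 3) := contDiff_radDeriv (contDiff_spaceDeriv hf i)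
  exact (ContDiff.mul (by fun_prop) (contDiff_radDeriv hf)).add (ContDiff.mul (by fun_prop)
    (((ContDiff.mul (by fun_prop) (h 0)).add (ContDiff.mul (by fun_prop) (h 1))).add
      (ContDiff.mul (by fun_prop) (h 2))))

/-- The inhomogeneous wave equation with smooth right-hand side has a global smooth solution. -/
theorem exists_wave_solution {f : Pt → ℝ} (hf : ContDiff ℝ (⊤ : ℕ∞) f) :
    ∃ u : Pt → ℝ, ContDiff ℝ (⊤ : ℕ∞) u ∧
      ∀ p, timeDeriv (timeDeriv u) p - lap3 u p = f p := by
  let g : Pt → ℝ := fun p => (4 * Real.pi)⁻¹ * f p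
  have hg : ContDiff ℝ (⊤ : ℕ∞) g := contDiff_const.mul hf
  have hK := contDiff_sphKer hg
  have hK1 : ContDiff ℝ (⊤ : ℕ∞) fun z =>
      Real.sin z.1.2 * g (sphPt z) + z.1.1.1 * Real.sin z.1.2 * radDeriv g z :=
    (ContDiff.mul (by fun_prop) (hg.comp contDiff_sphPt)).add
      (ContDiff.mul (by fun_prop) (contDiff_radDeriv hg))
  have hrad (s : ℝ) (p : Pt) (φ θ : ℝ) : HasDerivAt
      (fun s => Real.sin φ * g (sphPt (((s, p), φ), θ)) +
        s * Real.sin φ * radDeriv g (((s, p), φ), θ)) (radKer g (((s, p), φ), θ)) s := by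
    have h (i : Fin 3) := hasDerivAt_rad (contDiff_spaceDeriv hg i) s p φ θ
    have h' := ((hasDerivAt_rad hg s p φ θ).const_mul (Real.sin φ)).add
      (((hasDerivAt_id s).mul_const (Real.sin φ)).mul
        ((((h 0).const_mul (Real.sin φ * Real.cos θ)).add
          ((h 1).const_mul (Real.sin φ * Real.sin θ))).add ((h 2).const_mul (Real.cos φ))))
    refine h'.congr_deriv ?_
    simp only [radKer, radDeriv, id_eq, Pi.add_apply]
    ring
  have ht : (fun q => fderiv ℝ (sphInt (sphKer g)) q (1, 0)) = sphInt fun z =>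
      Real.sin z.1.2 * g (sphPt z) + z.1.1.1 * Real.sin z.1.2 * radDeriv g z := by
    funext q
    rw [fderiv_sphInt hK, fderiv_sphKer_time hg]
  have hx (i : Fin 3) : (fun q => fderiv ℝ (sphInt (sphKer g)) q (0, (0, Pi.single i 1))) =
      sphInt (sphKer (spaceDeriv i g)) := by
    funext q
    rw [fderiv_sphInt hK, fderiv_sphKer_space hg]
  refine exists_wave_solution_of_propagator (contDiff_sphInt hK) (fun p => ?_) (fun p => ?_)
    fun q => ?_
  · simp [sphInt, sphKer]
  · rw [congrFun ht (0, p)]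
    have hP (φ θ : ℝ) : sphPt (((0, p), φ), θ) = p := by
      refine Prod.ext rfl (funext fun i => ?_)
      fin_cases i <;> simp [sphPt]
    simp only [sphInt, hP, zero_mul, add_zero, intervalIntegral.integral_const,
      smul_eq_mul, sub_zero, intervalIntegral.integral_const_mul,
      intervalIntegral.integral_mul_const, integral_sin, g]
    have := Real.pi_ne_zero
    field_simp
    norm_num
  · rw [ht, fderiv_sphInt hK1]
    have h1 : (fun z => fderiv ℝ (fun z : ((ℝ × Pt) × ℝ) × ℝ =>
        Real.sin z.1.2 * g (sphPt z) + z.1.1.1 * Real.sin z.1.2 * radDeriv g z) z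
          ((((1, 0) : ℝ × Pt), (0 : ℝ)), (0 : ℝ))) = radKer g := by
      funext ⟨⟨⟨s, p⟩, φ⟩, θ⟩
      exact fderiv_time_of_hasDerivAt hK1 (hrad s p φ θ)
    rw [h1]
    have h2 (i : Fin 3) : fderiv ℝ (fun q => fderiv ℝ (sphInt (sphKer g)) q
        (0, (0, Pi.single i 1))) q (0, (0, Pi.single i 1)) =
        sphInt (sphKer (spaceDeriv i (spaceDeriv i g))) q := by
      rw [hx, fderiv_sphInt (contDiff_sphKer (contDiff_spaceDeriv hg i)),
        fderiv_sphKer_space (contDiff_spaceDeriv hg i)]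
    have hii (i : Fin 3) :=
      contDiff_sphKer (contDiff_spaceDeriv (contDiff_spaceDeriv hg i) i)
    have hD : ContDiff ℝ (⊤ : ℕ∞) fun z =>
        (∑ i : Fin 3, sphKer (spaceDeriv i (spaceDeriv i g)) z) - radKer g z :=
      (ContDiff.sum fun i _ => hii i).sub (contDiff_radKer hg)
    have h3 := sphInt_add hD (contDiff_radKer hg) q
    rw [sphInt_radKer hg, zero_add] at h3
    rw [← h3, Finset.sum_congr rfl fun i _ => h2 i]
    simp only [sub_add_cancel, Fin.sum_univ_three]
    rw [sphInt_add ((hii 0).add (hii 1)) (hii 2), sphInt_add (hii 0) (hii 1)]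

/-- Antiderivative in time, vanishing at time zero. -/
theorem exists_time_antideriv {f : Pt → ℝ} (hf : ContDiff ℝ (⊤ : ℕ∞) f) :
    ∃ F : Pt → ℝ, ContDiff ℝ (⊤ : ℕ∞) F ∧ (∀ p, timeDeriv F p = f p) ∧
      ∀ i p, spaceDeriv i F p = ∫ s in (0 : ℝ)..p.1, spaceDeriv i f (s, p.2) := by
  let e : (Fin 3 → ℝ) × ℝ →L[ℝ] Pt :=
    (ContinuousLinearMap.snd ℝ (Fin 3 → ℝ) ℝ).prod (ContinuousLinearMap.fst ℝ (Fin 3 → ℝ) ℝ)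
  let e' : Pt →L[ℝ] (Fin 3 → ℝ) × ℝ :=
    (ContinuousLinearMap.snd ℝ ℝ (Fin 3 → ℝ)).prod (ContinuousLinearMap.fst ℝ ℝ (Fin 3 → ℝ))
  have hfe : ContDiff ℝ (⊤ : ℕ∞) fun z => f (e z) := hf.comp e.contDiff
  obtain ⟨h1, h2⟩ := contDiff_and_fderiv_integral_upper hfe
  let G : (Fin 3 → ℝ) × ℝ → ℝ := fun z => ∫ s in (0 : ℝ)..z.2, f (e (z.1, s))
  have hG (p : Pt) (v : Pt) : fderiv ℝ (fun p => G (e' p)) p v = fderiv ℝ G (e' p) (e' v) := by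
    have h := ((h1.differentiable (by simp) (e' p)).hasFDerivAt.comp p e'.hasFDerivAt).fderiv
    exact congrArg (fun L => L v) h
  refine ⟨fun p => G (e' p), h1.comp e'.contDiff, fun p => ?_, fun i p => ?_⟩
  · refine ((hG p _).trans (h2 p.2 0 p.1 1)).trans ?_
    have hz (s : ℝ) : fderiv ℝ (fun z => f (e z)) (p.2, s) ((0 : Fin 3 → ℝ), (0 : ℝ)) = 0 :=
      map_zero _
    simp only [hz]
    simp [e]
  · refine ((hG p _).trans (h2 p.2 (Pi.single i 1) p.1 0)).trans ?_
    rw [zero_mul, zero_add]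
    refine intervalIntegral.integral_congr fun s _ => ?_
    have h := ((hf.differentiable (by simp) (e (p.2, s))).hasFDerivAt.comp (p.2, s)
      e.hasFDerivAt).fderiv
    exact congrArg (fun L => L (Pi.single i 1, (0 : ℝ))) h

/-- A time-independent antiderivative of the initial value of `f` in the first space variable. -/
theorem exists_space_antideriv {f : Pt → ℝ} (hf : ContDiff ℝ (⊤ : ℕ∞) f) :
    ∃ F : Pt → ℝ, ContDiff ℝ (⊤ : ℕ∞) F ∧ (∀ p, timeDeriv F p = 0) ∧
      ∀ p, spaceDeriv 0 F p = f (0, p.2) := by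
  let γ : Pt × ℝ → Pt := fun z => (0, ![z.2, z.1.2 1, z.1.2 2])
  have hγ : ContDiff ℝ (⊤ : ℕ∞) γ := by
    refine ContDiff.prodMk (by fun_prop) (contDiff_pi.2 fun i => ?_)
    fin_cases i <;> simp <;> fun_prop
  have hfγ : ContDiff ℝ (⊤ : ℕ∞) fun z => f (γ z) := hf.comp hγ
  obtain ⟨h1, h2⟩ := contDiff_and_fderiv_integral_upper hfγ
  let G : Pt × ℝ → ℝ := fun z => ∫ s in (0 : ℝ)..z.2, f (γ (z.1, s))
  let e : Pt →L[ℝ] Pt × ℝ := (ContinuousLinearMap.id ℝ Pt).prod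
    ((ContinuousLinearMap.proj (R := ℝ) (φ := fun _ : Fin 3 => ℝ) 0).comp
      (ContinuousLinearMap.snd ℝ ℝ (Fin 3 → ℝ)))
  have hG (p : Pt) (v : Pt) : fderiv ℝ (fun p => G (e p)) p v = fderiv ℝ G (e p) (e v) := by
    have h := ((h1.differentiable (by simp) (e p)).hasFDerivAt.comp p e.hasFDerivAt).fderiv
    exact congrArg (fun L => L v) h
  have hconst (x : Pt) (s : ℝ) (w : Pt) (hw1 : w.2 1 = 0) (hw2 : w.2 2 = 0) :
      fderiv ℝ (fun z => f (γ z)) (x, s) (w, 0) = 0 := by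
    refine fderiv_apply_eq_of_line (hfγ.differentiable (by simp)) (t := 0)
      (γ := fun t => (x + t • w, s)) ?_ (by simp) ?_
    · simpa using (((hasDerivAt_id (0 : ℝ)).smul_const w).const_add x).prodMk
        (hasDerivAt_const (0 : ℝ) s)
    · simpa [γ, hw1, hw2] using hasDerivAt_const (0 : ℝ) (f (0, ![s, x.2 1, x.2 2]))
  refine ⟨fun p => G (e p), h1.comp e.contDiff, fun p => ?_, fun p => ?_⟩
  · refine ((hG p _).trans (h2 p (1, 0) (p.2 0) 0)).trans ?_
    rw [zero_mul, zero_add, intervalIntegral.integral_congr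
      (g := fun _ => (0 : ℝ)) fun s _ => hconst p s (1, 0) (by simp) (by simp)]
    simp
  · have he : e ((0, Pi.single 0 1) : Pt) = ((0, Pi.single 0 1), 1) := by simp [e]
    refine ((hG p _).trans ?_)
    rw [he]
    refine (h2 p (0, Pi.single 0 1) (p.2 0) 1).trans ?_
    rw [one_mul, intervalIntegral.integral_congr
      (g := fun _ => (0 : ℝ)) fun s _ => hconst p s (0, Pi.single 0 1) (by simp) (by simp)]
    have hp : γ (p, p.2 0) = (0, p.2) := by
      refine Prod.ext rfl (funext fun i => ?_)
      fin_cases i <;> simp [γ]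
    simp [hp]

theorem timeDeriv_apply {F : Pt → Fin 3 → ℝ} (hF : ContDiff ℝ (⊤ : ℕ∞) F) (p : Pt) (i : Fin 3) :
    timeDeriv F p i = timeDeriv (fun q => F q i) p := by
  unfold timeDeriv
  rw [fderiv_apply (hF.differentiable (by simp) p)]
  rfl

theorem spaceDeriv_apply {F : Pt → Fin 3 → ℝ} (hF : ContDiff ℝ (⊤ : ℕ∞) F) (p : Pt)
    (k i : Fin 3) : spaceDeriv k F p i = spaceDeriv k (fun q => F q i) p := by
  unfold spaceDeriv
  rw [fderiv_apply (hF.differentiable (by simp) p)]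
  rfl

theorem timeDeriv_sub {f g : Pt → ℝ} (hf : ContDiff ℝ (⊤ : ℕ∞) f) (hg : ContDiff ℝ (⊤ : ℕ∞) g)
    (p : Pt) : timeDeriv (fun q => f q - g q) p = timeDeriv f p - timeDeriv g p := by
  unfold timeDeriv
  rw [fderiv_fun_sub (hf.differentiable (by simp) p) (hg.differentiable (by simp) p)]
  rfl

theorem spaceDeriv_sub {f g : Pt → ℝ} (hf : ContDiff ℝ (⊤ : ℕ∞) f) (hg : ContDiff ℝ (⊤ : ℕ∞) g)
    (i : Fin 3) (p : Pt) :
    spaceDeriv i (fun q => f q - g q) p = spaceDeriv i f p - spaceDeriv i g p := by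
  unfold spaceDeriv
  rw [fderiv_fun_sub (hf.differentiable (by simp) p) (hg.differentiable (by simp) p)]
  rfl

theorem fderiv_neg_sum_apply {v : Fin 3 → Pt → ℝ} (hv : ∀ i, ContDiff ℝ (⊤ : ℕ∞) (v i))
    (p w : Pt) : fderiv ℝ (fun q => -∑ i, v i q) p w = -∑ i, fderiv ℝ (v i) p w := by
  rw [fderiv_fun_neg, fderiv_fun_sum fun i _ => (hv i).differentiable (by simp) p]
  simp

/-- A conserved current is, up to sign, the time derivative and divergence of a vector field. -/
theorem exists_current_potential {ρ : Pt → ℝ} {j : Pt → Fin 3 → ℝ}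
    (hρ : ContDiff ℝ (⊤ : ℕ∞) ρ) (hj : ContDiff ℝ (⊤ : ℕ∞) j)
    (hcont : ∀ p : Pt, timeDeriv ρ p + div3 j p = 0) :
    ∃ g : Fin 3 → Pt → ℝ, (∀ i, ContDiff ℝ (⊤ : ℕ∞) (g i)) ∧
      (∀ i p, timeDeriv (g i) p = j p i) ∧ ∀ p, ∑ i, spaceDeriv i (g i) p = -ρ p := by
  have hji (i : Fin 3) : ContDiff ℝ (⊤ : ℕ∞) fun q => j q i := contDiff_pi.1 hj i
  choose F hF hFt hFx using fun i => exists_time_antideriv (hji i)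
  obtain ⟨a, ha, hat, hax⟩ := exists_space_antideriv hρ
  refine ⟨![fun q => F 0 q - a q, F 1, F 2], fun i => ?_, fun i p => ?_, fun p => ?_⟩
  · fin_cases i
    exacts [(hF 0).sub ha, hF 1, hF 2]
  · fin_cases i
    · exact (timeDeriv_sub (hF 0) ha p).trans (by rw [hFt, hat, sub_zero]; rfl)
    · exact hFt 1 p
    · exact hFt 2 p
  · rw [Fin.sum_univ_three]
    change spaceDeriv 0 (fun q => F 0 q - a q) p + spaceDeriv 1 (F 1) p + spaceDeriv 2 (F 2) p = _
    rw [spaceDeriv_sub (hF 0) ha, hax, hFx, hFx, hFx]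
    have hint (i : Fin 3) : IntervalIntegrable (fun s => spaceDeriv i (fun q => j q i) (s, p.2))
        MeasureTheory.volume 0 p.1 :=
      Continuous.intervalIntegrable ((contDiff_spaceDeriv (hji i) i).continuous.comp
        (by fun_prop : Continuous fun s : ℝ => (s, p.2))) _ _
    have htime : Continuous fun s : ℝ => timeDeriv ρ (s, p.2) :=
      (contDiff_timeDeriv hρ).continuous.comp (by fun_prop : Continuous fun s : ℝ => (s, p.2))
    have hftc : ∫ s in (0 : ℝ)..p.1, timeDeriv ρ (s, p.2) = ρ p - ρ (0, p.2) := by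
      rw [intervalIntegral.integral_eq_sub_of_hasDerivAt (f := fun s => ρ (s, p.2)) _
        (htime.intervalIntegrable _ _)]
      intro s _
      exact (hρ.differentiable (by simp) (s, p.2)).hasFDerivAt.comp_hasDerivAt s
        ((hasDerivAt_id s).prodMk (hasDerivAt_const s p.2))
    have hsum : ∫ s in (0 : ℝ)..p.1, timeDeriv ρ (s, p.2) =
        -∫ s in (0 : ℝ)..p.1, (spaceDeriv 0 (fun q => j q 0) (s, p.2) +
          spaceDeriv 1 (fun q => j q 1) (s, p.2) + spaceDeriv 2 (fun q => j q 2) (s, p.2)) := by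
      rw [← intervalIntegral.integral_neg]
      refine intervalIntegral.integral_congr fun s _ => ?_
      have h := hcont (s, p.2)
      simp only [div3, spaceDeriv_apply hj, Fin.sum_univ_three] at h
      linarith
    rw [intervalIntegral.integral_add ((hint 0).add (hint 1)) (hint 2),
      intervalIntegral.integral_add (hint 0) (hint 1), hftc] at hsum
    linarith

/-- Directional derivatives commute with the wave operator. -/
theorem wave_fderiv_apply {u : Pt → ℝ} (hu : ContDiff ℝ (⊤ : ℕ∞) u) (w p : Pt) :
    timeDeriv (timeDeriv fun q => fderiv ℝ u q w) p - lap3 (fun q => fderiv ℝ u q w) p =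
      fderiv ℝ (fun q => timeDeriv (timeDeriv u) q - lap3 u q) p w := by
  have h (v : Pt) : fderiv ℝ (fun q => fderiv ℝ (fun q => fderiv ℝ u q w) q v) p v =
      fderiv ℝ (fun q => fderiv ℝ (fun q => fderiv ℝ u q v) q v) p w := by
    rw [fderiv_fderiv_apply_comm (contDiff_fderiv_apply hu v) v w p]
    simp only [fderiv_fderiv_apply_comm hu w v]
  have hd (v : Pt) : DifferentiableAt ℝ
      (fun q => fderiv ℝ (fun q => fderiv ℝ u q v) q v) p :=
    (contDiff_fderiv_apply (contDiff_fderiv_apply hu v) v).differentiable (by simp) p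
  change _ = fderiv ℝ (fun q => fderiv ℝ (fun q => fderiv ℝ u q (1, 0)) q (1, 0) -
    ∑ i : Fin 3, fderiv ℝ (fun q => fderiv ℝ u q (0, Pi.single i 1)) q (0, Pi.single i 1)) p w
  rw [fderiv_fun_sub (hd _) (DifferentiableAt.fun_sum fun i _ => hd _),
    fderiv_fun_sum fun i _ => hd _]
  rw [sub_apply, sum_apply, ← h,
    Finset.sum_congr rfl fun i _ => (h _).symm]
  rfl

/-- Potentials in the Lorenz gauge satisfying the wave equations solve Maxwell's equations. -/
theorem maxwell_of_wave {ρ : Pt → ℝ} {j : Pt → Fin 3 → ℝ} {V : Pt → ℝ} {A : Pt → Fin 3 → ℝ}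
    (hV : ContDiff ℝ (⊤ : ℕ∞) V) (hA : ContDiff ℝ (⊤ : ℕ∞) A)
    (hL : ∀ p : Pt, timeDeriv V p + div3 A p = 0)
    (hVw : ∀ p : Pt, timeDeriv (timeDeriv V) p - lap3 V p = ρ p)
    (hAw : ∀ (p : Pt) (i : Fin 3),
      timeDeriv (timeDeriv A) p i - lap3 (fun q => A q i) p = j p i) :
    (∀ p : Pt, div3 (fun q => -timeDeriv A q - grad3 V q) p = ρ p) ∧
      ∀ p : Pt,
        -timeDeriv (fun q => -timeDeriv A q - grad3 V q) p + curl3 (curl3 A) p = j p := by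
  have hAi (i : Fin 3) : ContDiff ℝ (⊤ : ℕ∞) fun q => A q i := contDiff_pi.1 hA i
  have hAt : ContDiff ℝ (⊤ : ℕ∞) (timeDeriv A) :=
    (hA.fderiv_right (by simp)).clm_apply contDiff_const
  have hgrad : ContDiff ℝ (⊤ : ℕ∞) (grad3 V) := contDiff_pi.2 fun i => contDiff_spaceDeriv hV i
  have hE : ContDiff ℝ (⊤ : ℕ∞) fun q => -timeDeriv A q - grad3 V q := hAt.neg.sub hgrad
  have hcurl : ContDiff ℝ (⊤ : ℕ∞) (curl3 A) := by
    refine contDiff_pi.2 fun i => ?_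
    have h (k l : Fin 3) : ContDiff ℝ (⊤ : ℕ∞) fun q => spaceDeriv k A q l := by
      simp only [spaceDeriv_apply hA]
      exact contDiff_spaceDeriv (hAi l) k
    fin_cases i
    exacts [(h 1 2).sub (h 2 1), (h 2 0).sub (h 0 2), (h 0 1).sub (h 1 0)]
  have hEi (i : Fin 3) : (fun q => (-timeDeriv A q - grad3 V q) i) =
      fun q => -timeDeriv (fun q => A q i) q - spaceDeriv i V q := by
    funext q
    simp [grad3, timeDeriv_apply hA]
  have hdE (i : Fin 3) (p w : Pt) : fderiv ℝ (fun q => (-timeDeriv A q - grad3 V q) i) p w =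
      -fderiv ℝ (timeDeriv fun q => A q i) p w - fderiv ℝ (spaceDeriv i V) p w := by
    rw [hEi, fderiv_fun_sub ((contDiff_timeDeriv (hAi i)).neg.differentiable (by simp) p)
      ((contDiff_spaceDeriv hV i).differentiable (by simp) p), fderiv_fun_neg]
    rfl
  have hLw : timeDeriv V = fun q => -∑ i, spaceDeriv i (fun q => A q i) q := by
    funext q
    have h := hL q
    simp only [div3, spaceDeriv_apply hA] at h
    linarith
  have hdL (p w : Pt) : fderiv ℝ (timeDeriv V) p w =
      -∑ i, fderiv ℝ (spaceDeriv i fun q => A q i) p w := by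
    rw [hLw]
    exact fderiv_neg_sum_apply (fun i => contDiff_spaceDeriv (hAi i) i) p w
  refine ⟨fun p => ?_, fun p => funext fun i => ?_⟩
  · have h1 (i : Fin 3) : spaceDeriv i (fun q => -timeDeriv A q - grad3 V q) p i =
        -timeDeriv (spaceDeriv i fun q => A q i) p - spaceDeriv i (spaceDeriv i V) p := by
      rw [spaceDeriv_apply hE, ← spaceDeriv_timeDeriv_comm (hAi i)]
      exact hdE i p _
    have h2 : timeDeriv (timeDeriv V) p = -∑ i, timeDeriv (spaceDeriv i fun q => A q i) p :=
      hdL p _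
    rw [← hVw p, h2, div3, Finset.sum_congr rfl fun i _ => h1 i, Finset.sum_sub_distrib,
      Finset.sum_neg_distrib]
    rfl
  · have h1 : timeDeriv (fun q => -timeDeriv A q - grad3 V q) p i =
        -timeDeriv (timeDeriv fun q => A q i) p - spaceDeriv i (timeDeriv V) p := by
      rw [timeDeriv_apply hE, spaceDeriv_timeDeriv_comm hV]
      exact hdE i p _
    have h2 : spaceDeriv i (timeDeriv V) p =
        -∑ k, spaceDeriv i (spaceDeriv k fun q => A q k) p := hdL p _
    have h3 : timeDeriv (timeDeriv A) p i = timeDeriv (timeDeriv fun q => A q i) p := by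
      rw [timeDeriv_apply hAt]
      simp only [timeDeriv_apply hA]
    have h4 (k l m n r : Fin 3) : spaceDeriv k (fun q => spaceDeriv l A q m - spaceDeriv n A q r) p
        = spaceDeriv k (spaceDeriv l fun q => A q m) p -
          spaceDeriv k (spaceDeriv n fun q => A q r) p := by
      simp only [spaceDeriv_apply hA]
      exact spaceDeriv_sub (contDiff_spaceDeriv (hAi m) l) (contDiff_spaceDeriv (hAi r) n) k p
    have hc (k l : Fin 3) := spaceDeriv_apply hcurl p k l
    have hw := hAw p i
    rw [h3] at hw
    rw [← hw, Pi.add_apply, Pi.neg_apply, h1, h2]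
    simp only [lap3, Fin.sum_univ_three]
    have hcc : curl3 (curl3 A) p i = (spaceDeriv i (spaceDeriv 0 fun q => A q 0) p +
        spaceDeriv i (spaceDeriv 1 fun q => A q 1) p +
        spaceDeriv i (spaceDeriv 2 fun q => A q 2) p) -
        (spaceDeriv 0 (spaceDeriv 0 fun q => A q i) p +
        spaceDeriv 1 (spaceDeriv 1 fun q => A q i) p +
        spaceDeriv 2 (spaceDeriv 2 fun q => A q i) p) := by
      have c0 (q : Pt) : curl3 A q 0 = spaceDeriv 1 A q 2 - spaceDeriv 2 A q 1 := rfl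
      have c1 (q : Pt) : curl3 A q 1 = spaceDeriv 2 A q 0 - spaceDeriv 0 A q 2 := rfl
      have c2 (q : Pt) : curl3 A q 2 = spaceDeriv 0 A q 1 - spaceDeriv 1 A q 0 := rfl
      have hm (k l m : Fin 3) := spaceDeriv_comm (hAi m) k l p
      fin_cases i
      · change spaceDeriv 1 (curl3 A) p 2 - spaceDeriv 2 (curl3 A) p 1 = _
        simp only [hc, c1, c2, h4]
        rw [hm 1 0 1, hm 2 0 2]
        simp
        ring
      · change spaceDeriv 2 (curl3 A) p 0 - spaceDeriv 0 (curl3 A) p 2 = _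
        simp only [hc, c0, c2, h4]
        rw [hm 2 1 2, hm 0 1 0]
        simp
        ring
      · change spaceDeriv 0 (curl3 A) p 1 - spaceDeriv 1 (curl3 A) p 0 = _
        simp only [hc, c0, c1, h4]
        rw [hm 0 2 0, hm 1 2 1]
        simp
        ring
    rw [hcc]
    change _ = _ - (spaceDeriv 0 (spaceDeriv 0 fun q => A q i) p +
      spaceDeriv 1 (spaceDeriv 1 fun q => A q i) p + spaceDeriv 2 (spaceDeriv 2 fun q => A q i) p)
    ring

/-- Let `ρ : ℝ⁴ → ℝ` and `j : ℝ⁴ → ℝ³` be smooth and satisfy the continuity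
equation `∂_tρ + div j = 0` everywhere. Then there exist smooth potentials `V : ℝ⁴ → ℝ` and
`A : ℝ⁴ → ℝ³` satisfying the Lorenz gauge condition `∂_tV + div A = 0` together with the wave
equations `∂_t²V − ΔV = ρ` and `∂_t²A − ΔA = j`; consequently the fields `E := −∂_tA − grad V`
and `B := curl A` satisfy `div E = ρ` and `−∂_tE + curl B = j`. -/
theorem exists_potentials_of_conserved (ρ : Pt → ℝ) (j : Pt → Fin 3 → ℝ)
    (hρ : ContDiff ℝ (⊤ : ℕ∞) ρ) (hj : ContDiff ℝ (⊤ : ℕ∞) j)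
    (hcont : ∀ p : Pt, timeDeriv ρ p + div3 j p = 0) :
    ∃ (V : Pt → ℝ) (A : Pt → Fin 3 → ℝ), ContDiff ℝ (⊤ : ℕ∞) V ∧ ContDiff ℝ (⊤ : ℕ∞) A ∧
      (∀ p : Pt, timeDeriv V p + div3 A p = 0) ∧
      (∀ p : Pt, timeDeriv (timeDeriv V) p - lap3 V p = ρ p) ∧
      (∀ (p : Pt) (i : Fin 3),
        timeDeriv (timeDeriv A) p i - lap3 (fun q => A q i) p = j p i) ∧
      (∀ p : Pt, div3 (fun q => -timeDeriv A q - grad3 V q) p = ρ p) ∧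
      (∀ p : Pt,
        -timeDeriv (fun q => -timeDeriv A q - grad3 V q) p + curl3 (curl3 A) p = j p) := by

  obtain ⟨g, hg, hgt, hgx⟩ := exists_current_potential hρ hj hcont
  choose u hu huw using fun i => exists_wave_solution (hg i)
  have huw' (i : Fin 3) : (fun q => timeDeriv (timeDeriv (u i)) q - lap3 (u i) q) = g i :=
    funext (huw i)
  let V : Pt → ℝ := fun q => -∑ i, spaceDeriv i (u i) q
  let A : Pt → Fin 3 → ℝ := fun q i => timeDeriv (u i) q
  have hux (i : Fin 3) := contDiff_spaceDeriv (hu i) i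
  have hV : ContDiff ℝ (⊤ : ℕ∞) V := (ContDiff.sum fun i _ => hux i).neg
  have hA : ContDiff ℝ (⊤ : ℕ∞) A := contDiff_pi.2 fun i => contDiff_timeDeriv (hu i)
  have hAt : ContDiff ℝ (⊤ : ℕ∞) (timeDeriv A) :=
    (hA.fderiv_right (by simp)).clm_apply contDiff_const
  have hL (p : Pt) : timeDeriv V p + div3 A p = 0 := by
    have h1 : timeDeriv V p = -∑ i, timeDeriv (spaceDeriv i (u i)) p :=
      fderiv_neg_sum_apply hux p _
    have h2 (i : Fin 3) : spaceDeriv i A p i = timeDeriv (spaceDeriv i (u i)) p := by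
      rw [spaceDeriv_apply hA, ← spaceDeriv_timeDeriv_comm (hu i)]
    rw [h1, div3, Finset.sum_congr rfl fun i _ => h2 i, neg_add_cancel]
  have hVw (p : Pt) : timeDeriv (timeDeriv V) p - lap3 V p = ρ p := by
    have hvv (v : Pt) : fderiv ℝ (fun q => fderiv ℝ V q v) p v =
        -∑ i, fderiv ℝ (fun q => fderiv ℝ (spaceDeriv i (u i)) q v) p v := by
      have h : (fun q => fderiv ℝ V q v) = fun q => -∑ i, fderiv ℝ (spaceDeriv i (u i)) q v :=
        funext fun q => fderiv_neg_sum_apply hux q v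
      rw [h]
      exact fderiv_neg_sum_apply (fun i => contDiff_fderiv_apply (hux i) v) p v
    have hsum : timeDeriv (timeDeriv V) p - lap3 V p =
        -∑ i, (timeDeriv (timeDeriv (spaceDeriv i (u i))) p - lap3 (spaceDeriv i (u i)) p) := by
      have ht : timeDeriv (timeDeriv V) p = -∑ i, timeDeriv (timeDeriv (spaceDeriv i (u i))) p :=
        hvv _
      have hx : lap3 V p = ∑ k : Fin 3, -∑ i, spaceDeriv k (spaceDeriv k (spaceDeriv i (u i))) p :=
        Finset.sum_congr rfl fun k _ => hvv _
      rw [ht, hx, Finset.sum_sub_distrib, Finset.sum_neg_distrib, Finset.sum_comm]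
      simp only [lap3]
      ring
    have hw (i : Fin 3) : timeDeriv (timeDeriv (spaceDeriv i (u i))) p -
        lap3 (spaceDeriv i (u i)) p = spaceDeriv i (g i) p := by
      rw [← huw' i]
      exact wave_fderiv_apply (hu i) _ p
    rw [hsum, Finset.sum_congr rfl fun i _ => hw i, hgx, neg_neg]
  have hAw (p : Pt) (i : Fin 3) :
      timeDeriv (timeDeriv A) p i - lap3 (fun q => A q i) p = j p i := by
    have h : timeDeriv (timeDeriv A) p i = timeDeriv (timeDeriv fun q => A q i) p := by
      rw [timeDeriv_apply hAt]
      simp only [timeDeriv_apply hA]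
    rw [h, ← hgt, ← huw' i]
    exact wave_fderiv_apply (hu i) _ p
  exact ⟨V, A, hV, hA, hL, hVw, hAw, maxwell_of_wave hV hA hL hVw hAw⟩

end
end
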